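/- arXiv:math/0602354 — 2 statements merged into one kernel-verified Lean document; each statement's English description precedes it below -/
import Mathlib

section
/- For every positive, unbounded, increasing function Ψ on ℝ₊ with Ψ(x) = o(x) as x → ∞, there exist a real-analytic function F : ℝ → ℝ that is 1-periodic and satisfies ∫₀¹ F(x) dx = 0, and a real number α, such that 0 < limsup_{N→∞} ( max_{0 ≤ x < 1} W'(N,x,α) ) / Ψ(N) < ∞, where W'(N,x,α) = Σ_{k=0}^{N-1} F'(x + kα). -/
open Filter

/-- One step of the construction: choice of coefficient and time scale. -/
lemma slow_step (Ψ : ℝ → ℝ)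
    (hΨpos : ∀ x > 0, 0 < Ψ x)
    (hΨmono : Monotone Ψ)
    (hΨunbdd : Tendsto Ψ atTop atTop)
    (hΨo : Ψ =o[atTop] fun x => x) (ε K : ℝ) (hε : 0 < ε) :
    ∃ (a : ℝ) (M : ℕ), 0 < a ∧ a ≤ ε ∧ 1 ≤ M ∧ (∀ N : ℕ, 1 ≤ N → N ≤ M → a * N ≤ Ψ N) ∧
      Ψ M ≤ 2 * (a * M) ∧ K ≤ Ψ M := by
  have h1 : 0 < Ψ 1 := hΨpos 1 one_pos
  obtain ⟨X, hX⟩ := (tendsto_atTop.1 hΨunbdd K).exists_forall_of_atTop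
  obtain ⟨R, hR⟩ := exists_nat_gt (max X 1)
  have hRX : X < R := (le_max_left _ _).trans_lt hR
  have hR1 : (1:ℝ) < R := (le_max_right _ _).trans_lt hR
  set a := min ε (Ψ 1 / (R + 1)) with ha
  have ha0 : 0 < a := lt_min hε (by positivity)
  have haR : a * (R + 1) ≤ Ψ 1 := by
    have : a ≤ Ψ 1 / (R + 1) := min_le_right _ _
    rwa [le_div_iff₀ (by positivity)] at this
  have hex : ∃ N : ℕ, 1 ≤ N ∧ Ψ N < a * N := by
    have h2 := (hΨo.def (half_pos ha0))
    obtain ⟨Y, hY⟩ := h2.exists_forall_of_atTop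
    obtain ⟨N, hN⟩ := exists_nat_gt (max Y 1)
    have hNY : Y < N := (le_max_left _ _).trans_lt hN
    have hN1 : (1:ℝ) < N := (le_max_right _ _).trans_lt hN
    refine ⟨N, by exact_mod_cast hN1.le, ?_⟩
    have := hY N hNY.le
    rw [Real.norm_eq_abs, Real.norm_eq_abs, abs_of_pos (show (0:ℝ) < N by linarith)] at this
    have h3 := le_abs_self (Ψ N)
    nlinarith
  classical
  have hs := Nat.find_spec hex
  have hm : ∀ N : ℕ, N < Nat.find hex → 1 ≤ N → a * N ≤ Ψ N := by
    intro N hN h1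
    have := Nat.find_min hex hN
    push Not at this
    exact this h1
  set P := Nat.find hex with hP
  obtain ⟨hP1, hP2⟩ := hs
  have hPR : R + 1 < P := by
    by_contra hcon
    have h4 : (P:ℝ) ≤ R + 1 := by exact_mod_cast not_lt.1 hcon
    have h5 : Ψ 1 ≤ Ψ P := hΨmono (by exact_mod_cast hP1)
    nlinarith
  have hMc : (((P - 1 : ℕ)) : ℝ) = P - 1 := by push_cast [hP1]; ring
  have hPR' : (R:ℝ) + 1 < P := by exact_mod_cast hPR
  refine ⟨a, P - 1, ha0, min_le_left _ _, by omega, ?_, ?_, ?_⟩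
  · intro N h1 h2
    exact hm N (by omega) h1
  · have h6 : Ψ ((P - 1 : ℕ) : ℝ) ≤ Ψ P := hΨmono (by rw [hMc]; linarith)
    rw [hMc] at *
    nlinarith
  · apply hX
    rw [hMc]; linarith

/-- Dirichlet kernel bound. -/
lemma dirichlet_bound (N L : ℕ) (hL : 4 ≤ L) (y β θ : ℝ) (p : ℤ) (hβ : β = p + θ)
    (h1 : 1 / (L:ℝ) ≤ θ) (h2 : θ ≤ 2 / L) :
    |∑ k ∈ Finset.range N, Real.cos (y + k * (2 * Real.pi * β))| ≤ L / 2 := by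
  have hL' : (4:ℝ) ≤ L := by exact_mod_cast hL
  have hθ0 : 0 < θ := lt_of_lt_of_le (by positivity) h1
  have hθ2 : θ ≤ 1 / 2 := h2.trans (by rw [div_le_div_iff₀ (by positivity) (by positivity)]; linarith)
  have hs : 2 * θ ≤ Real.sin (Real.pi * θ) := by
    have := Real.mul_le_sin (x := Real.pi * θ) (by positivity) (by nlinarith [Real.pi_pos])
    have e : 2 / Real.pi * (Real.pi * θ) = 2 * θ := by field_simp
    rwa [e] at this
  have hc : ∀ k : ℕ, Real.cos (y + k * (2 * Real.pi * β)) = Real.cos (y + k * (2 * Real.pi * θ)) := by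
    intro k
    rw [hβ, show y + k * (2 * Real.pi * (p + θ)) =
      (y + k * (2 * Real.pi * θ)) + ((k * p : ℤ) : ℝ) * (2 * Real.pi) by push_cast; ring,
      Real.cos_add_int_mul_two_pi]
  have key : 2 * Real.sin (Real.pi * θ) * ∑ k ∈ Finset.range N, Real.cos (y + k * (2 * Real.pi * β))
      = Real.sin (y + N * (2 * Real.pi * θ) - Real.pi * θ) - Real.sin (y - Real.pi * θ) := by
    rw [Finset.mul_sum]
    induction N with
    | zero => simp
    | succ n ih =>
      rw [Finset.sum_range_succ, ih, hc]
      rw [show y + ((n + 1 : ℕ) : ℝ) * (2 * Real.pi * θ) - Real.pi * θ =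
        (y + n * (2 * Real.pi * θ)) + Real.pi * θ by push_cast; ring]
      rw [Real.sin_sub, Real.sin_add (y + n * (2 * Real.pi * θ))]
      ring
  set S := ∑ k ∈ Finset.range N, Real.cos (y + k * (2 * Real.pi * β))
  have h3 : |2 * Real.sin (Real.pi * θ) * S| ≤ 2 := by
    rw [key]
    have e1 := Real.abs_sin_le_one (y + N * (2 * Real.pi * θ) - Real.pi * θ)
    have e2 := Real.abs_sin_le_one (y - Real.pi * θ)
    exact (abs_sub _ _).trans (by linarith)
  rw [abs_mul, abs_of_pos (by linarith)] at h3
  have h4 : 2 / (L:ℝ) ≤ Real.sin (Real.pi * θ) := by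
    refine le_trans ?_ hs
    rw [div_eq_mul_one_div]; linarith
  have h5 : 2 * (2 / (L:ℝ)) * |S| ≤ 2 := by
    refine le_trans ?_ h3
    gcongr
  have e : 2 * (2 / (L:ℝ)) * |S| = |S| * 4 / L := by ring
  rw [e, div_le_iff₀ (by positivity)] at h5
  linarith

/-- The frequency `α`. -/
lemma exists_alpha (q L : ℕ → ℕ) (hq : ∀ n, 1 ≤ q n) (hL : ∀ n, 2 ≤ L n)
    (hs : ∀ n, q (n + 1) = L n * q n) :
    ∃ α : ℝ, ∀ n, ∃ (p : ℤ) (θ : ℝ), q n * α = p + θ ∧ 1 / (L n : ℝ) ≤ θ ∧ θ ≤ 2 / L n := by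
  have hqp : ∀ n, (0:ℝ) < q n := fun n => by exact_mod_cast hq n
  have hgrow : ∀ n j, (2:ℝ) ^ j * q n ≤ q (n + j) := by
    intro n j
    induction j with
    | zero => simp
    | succ j ih =>
      rw [← add_assoc, hs, pow_succ]
      have : (2:ℝ) ≤ L (n + j) := by exact_mod_cast hL _
      push_cast
      nlinarith [hqp (n + j)]
  have hb : ∀ n j, 1 / (q (n + j) : ℝ) ≤ 1 / q n * (1 / 2) ^ j := by
    intro n j
    have := hgrow n j
    rw [one_div_pow, one_div_mul_one_div, mul_comm (q n : ℝ)]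
    exact one_div_le_one_div_of_le (by have := hqp n; positivity) this
  have hgs : ∀ n, Summable fun j => 1 / (q n : ℝ) * (1 / 2) ^ j := fun n =>
    summable_geometric_two.mul_left _
  have hsum : ∀ n, Summable fun j => 1 / (q (n + j) : ℝ) := fun n =>
    Summable.of_nonneg_of_le (fun j => by positivity) (hb n) (hgs n)
  have hsum0 : Summable fun j => 1 / (q j : ℝ) := by simpa using hsum 0
  have hdvd : ∀ n m, m ≤ n → q m ∣ q n := by
    intro n m h
    induction n, h using Nat.le_induction with
    | base => exact dvd_rfl
    | succ n _ ih => rw [hs]; exact ih.mul_left _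
  refine ⟨∑' j, 1 / (q j : ℝ), fun n => ⟨∑ m ∈ Finset.range (n + 1), ((q n / q m : ℕ) : ℤ),
    q n * ∑' j, 1 / (q (n + 1 + j) : ℝ), ?_, ?_, ?_⟩⟩
  · rw [← hsum0.sum_add_tsum_nat_add (n + 1), mul_add, Finset.mul_sum]
    congr 1
    · rw [Int.cast_sum]
      refine Finset.sum_congr rfl fun m hm => ?_
      rw [Int.cast_natCast, Nat.cast_div (hdvd n m (by simpa [Nat.lt_succ_iff] using hm)) (hqp m).ne']
      ring
    · congr 1
      exact tsum_congr fun j => by rw [add_comm]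
  · have h := (hsum (n + 1)).le_tsum 0 (fun j _ => by positivity)
    have e : (1:ℝ) / L n = q n * (1 / (q (n + 1 + 0) : ℝ)) := by
      have := (hqp n).ne'
      have : (L n : ℝ) ≠ 0 := by have := hL n; positivity
      rw [add_zero, hs]; push_cast; field_simp
    rw [e]
    exact mul_le_mul_of_nonneg_left h (hqp n).le
  · have h := (hsum (n + 1)).tsum_le_tsum (hb (n + 1)) (hgs (n + 1))
    rw [tsum_mul_left, tsum_geometric_two] at h
    have e : (2:ℝ) / L n = q n * (1 / (q (n + 1) : ℝ) * 2) := by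
      have := (hqp n).ne'
      have : (L n : ℝ) ≠ 0 := by have := hL n; positivity
      rw [hs]; push_cast; field_simp
    rw [e]
    exact mul_le_mul_of_nonneg_left h (hqp n).le

/-- The lacunary sine series is analytic, periodic, of mean zero and can be differentiated. -/
lemma series_props (q : ℕ → ℕ) (a : ℕ → ℝ) (u : ℕ → ℝ) (hq : ∀ n, 1 ≤ q n) (ha : ∀ n, 0 < a n)
    (hu : Summable u) (hau : ∀ n, a n * Real.exp (q n) ≤ u n) :
    ∃ F : ℝ → ℝ, AnalyticOnNhd ℝ F Set.univ ∧ Function.Periodic F 1 ∧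
      (∫ x in (0:ℝ)..1, F x) = 0 ∧
      ∀ x, HasSum (fun n => a n * Real.cos (2 * Real.pi * q n * x)) (deriv F x) := by
  have hπ := Real.pi_pos
  have hqp : ∀ n, (1:ℝ) ≤ q n := fun n => by exact_mod_cast hq n
  let b : ℕ → ℝ := fun n => a n / (2 * Real.pi * q n)
  have hb0 : ∀ n, 0 ≤ b n := fun n => by
    have := ha n; have := hqp n; positivity
  have hba : ∀ n, b n ≤ a n := fun n => by
    refine div_le_self (ha n).le ?_
    have := Real.pi_gt_three
    nlinarith [hqp n]
  have hale : ∀ n, a n ≤ u n := fun n => by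
    have : 1 ≤ Real.exp (q n) := Real.one_le_exp (by linarith [hqp n])
    nlinarith [hau n, ha n]
  let S : Set ℂ := {z | |z.im| < 1 / (2 * Real.pi)}
  have hSo : IsOpen S := isOpen_lt (by fun_prop) continuous_const
  let g : ℕ → ℂ → ℂ := fun n z => b n * Complex.exp (2 * Real.pi * q n * z * Complex.I)
  have hgn : ∀ n z, z ∈ S → ‖g n z‖ ≤ u n := by
    intro n z hz
    have hz' : |z.im| < 1 / (2 * Real.pi) := hz
    simp only [g, norm_mul, Complex.norm_real, Complex.norm_exp, Real.norm_eq_abs, abs_of_nonneg (hb0 n)]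
    refine le_trans ?_ (hau n)
    have hre : (2 * Real.pi * q n * z * Complex.I).re ≤ q n := by
      have e : (2 * Real.pi * q n * z * Complex.I).re = - (2 * Real.pi * q n * z.im) := by
        rw [Complex.mul_I_re]
        have : (2 * Real.pi * q n * z : ℂ) = ((2 * Real.pi * q n : ℝ) : ℂ) * z := by push_cast; ring
        rw [this, Complex.im_ofReal_mul]
      rw [e]
      rw [lt_div_iff₀ (by positivity)] at hz'
      have := neg_abs_le z.im
      have h0 := hqp n
      have : -z.im * (2 * Real.pi) ≤ 1 := by nlinarith
      nlinarith
    exact mul_le_mul (hba n) (Real.exp_le_exp.2 hre) (Real.exp_pos _).le (ha n).le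
  let G : ℂ → ℂ := fun z => ∑' n, g n z
  have hGd : DifferentiableOn ℂ G S := by
    apply Complex.differentiableOn_tsum_of_summable_norm hu _ hSo hgn
    intro n
    apply Differentiable.differentiableOn
    fun_prop
  have hGa : AnalyticOnNhd ℂ G S := hGd.analyticOnNhd hSo
  let F : ℝ → ℝ := fun x => ∑' n, b n * Real.sin (2 * Real.pi * q n * x)
  have hmemS : ∀ x : ℝ, (x:ℂ) ∈ S := fun x => by
    change |(x:ℂ).im| < _
    simp; positivity
  have hFG : F = fun x : ℝ => (G x).im := by
    funext x
    have hsm : Summable fun n => g n x := Summable.of_norm_bounded hu (fun n => hgn n x (hmemS x))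
    change _ = Complex.imCLM (∑' n, g n x)
    rw [Complex.imCLM.map_tsum hsm]
    refine tsum_congr fun n => ?_
    simp only [g, Complex.imCLM_apply, Complex.im_ofReal_mul]
    congr 1
    have : (2 * Real.pi * q n * x * Complex.I : ℂ) = ((2 * Real.pi * q n * x : ℝ) : ℂ) * Complex.I := by
      push_cast; ring
    rw [this, Complex.exp_ofReal_mul_I_im]
  have hFa : AnalyticOnNhd ℝ F Set.univ := by
    rw [hFG]
    intro x _
    have h1 : AnalyticAt ℝ G (x:ℂ) := (hGa x (hmemS x)).restrictScalars
    have h2 : AnalyticAt ℝ (fun x : ℝ => (x:ℂ)) x := Complex.ofRealCLM.analyticAt x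
    have h3 : AnalyticAt ℝ (fun x : ℝ => G (x:ℂ)) x := AnalyticAt.fun_comp h1 h2
    exact (Complex.imCLM.analyticAt _).fun_comp h3
  have hper : Function.Periodic F 1 := by
    intro x
    refine tsum_congr fun n => ?_
    rw [show 2 * Real.pi * q n * (x + 1) = 2 * Real.pi * q n * x + (q n : ℝ) * (2 * Real.pi) by ring,
      Real.sin_add_nat_mul_two_pi]
  have hodd : ∀ x, F (-x) = - F x := by
    intro x
    simp only [F]
    rw [← tsum_neg]
    refine tsum_congr fun n => ?_
    rw [mul_neg, Real.sin_neg]; ring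
  refine ⟨F, hFa, hper, ?_, ?_⟩
  · have h1 : (∫ x in (0:ℝ)..1, F (1 - x)) = ∫ x in (0:ℝ)..1, F x := by
      rw [intervalIntegral.integral_comp_sub_left]; simp
    have h2 : (∫ x in (0:ℝ)..1, F (1 - x)) = - ∫ x in (0:ℝ)..1, F x := by
      rw [← intervalIntegral.integral_neg]
      congr 1
      funext x
      rw [← hodd, ← hper (-x)]; congr 1; ring
    linarith
  · intro x
    have hd : HasDerivAt F (∑' n, a n * Real.cos (2 * Real.pi * q n * x)) x := by
      refine hasDerivAt_tsum (u := u) hu (g := fun n x => b n * Real.sin (2 * Real.pi * q n * x))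
        (g' := fun n x => a n * Real.cos (2 * Real.pi * q n * x)) (y₀ := 0) ?_ ?_ ?_ x
      · intro n y
        have h1 : HasDerivAt (fun y : ℝ => 2 * Real.pi * q n * y) (2 * Real.pi * q n) y := by
          simpa using (hasDerivAt_id y).const_mul (2 * Real.pi * q n)
        have := (h1.sin).const_mul (b n)
        have h0 := hqp n
        have e : b n * (Real.cos (2 * Real.pi * q n * y) * (2 * Real.pi * q n)) =
            a n * Real.cos (2 * Real.pi * q n * y) := by
          change a n / (2 * Real.pi * q n) * _ = _
          field_simp
        rwa [e] at this
      · intro n y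
        rw [norm_mul, Real.norm_eq_abs, Real.norm_eq_abs, abs_of_pos (ha n)]
        have := Real.abs_cos_le_one (2 * Real.pi * q n * y)
        nlinarith [ha n, hale n]
      · simp
    rw [hd.deriv]
    refine (Summable.of_norm_bounded hu fun n => ?_).hasSum
    rw [norm_mul, Real.norm_eq_abs, Real.norm_eq_abs, abs_of_pos (ha n)]
    have := Real.abs_cos_le_one (2 * Real.pi * q n * x)
    nlinarith [ha n, hale n]

/-- **Borichev's theorem.** For every admissible `Ψ` (positive, unbounded, increasing,
`Ψ(x) = o(x)`), there exist a real-analytic `1`-periodic `F : ℝ → ℝ` with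
`∫₀¹ F = 0` and `α ∈ ℝ` such that
`0 < limsup_N (max_{0 ≤ x < 1} W'(N,x,α)) / Ψ(N) < ∞`,
where `W'(N,x,α) = ∑_{k<N} F'(x + kα)`. -/
theorem borichev_slow_weyl_sums
    (Ψ : ℝ → ℝ)
    (hΨpos : ∀ x > 0, 0 < Ψ x)
    (hΨmono : Monotone Ψ)
    (hΨunbdd : Tendsto Ψ atTop atTop)
    (hΨo : Ψ =o[atTop] fun x => x) :
    ∃ (F : ℝ → ℝ) (α : ℝ),
      AnalyticOnNhd ℝ F Set.univ ∧
      Function.Periodic F 1 ∧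
      (∫ x in (0:ℝ)..1, F x) = 0 ∧
      0 < Filter.limsup
          (fun N : ℕ =>
            (((⨆ x : Set.Ico (0:ℝ) 1,
                ∑ k ∈ Finset.range N, deriv F ((x : ℝ) + k * α)) / Ψ N : ℝ) : EReal))
          atTop ∧
      Filter.limsup
          (fun N : ℕ =>
            (((⨆ x : Set.Ico (0:ℝ) 1,
                ∑ k ∈ Finset.range N, deriv F ((x : ℝ) + k * α)) / Ψ N : ℝ) : EReal))
          atTop < ⊤ := by
  have hc : 0 < Ψ 1 := hΨpos 1 one_pos
  choose a M ha0 haε hM1 haN hΨM hK using fun q : ℕ =>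
    slow_step Ψ hΨpos hΨmono hΨunbdd hΨo (Ψ 1 * Real.exp (-q) / ((q:ℝ) ^ 2 + 1)) (1000 * Ψ 1 * q)
      (by positivity)
  obtain ⟨q, hq0, hqs⟩ : ∃ q : ℕ → ℕ, q 0 = 1 ∧ ∀ n, q (n + 1) = 16 * M (q n) * q n :=
    ⟨fun n => Nat.rec 1 (fun _ r => 16 * M r * r) n, rfl, fun n => rfl⟩
  have hq1 : ∀ n, 1 ≤ q n := by
    intro n
    induction n with
    | zero => exact hq0.ge
    | succ n ih =>
      rw [hqs]
      have := hM1 (q n)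
      exact Nat.mul_pos (by omega) ih
  have hqp : ∀ n : ℕ, (1:ℝ) ≤ (q n : ℕ) := fun n => by exact_mod_cast hq1 n
  have hMp : ∀ n : ℕ, (1:ℝ) ≤ (M n : ℕ) := fun n => by exact_mod_cast hM1 n
  have hqlt : ∀ n, q n < q (n + 1) := by
    intro n
    rw [hqs]
    have h1 := hM1 (q n)
    have h2 := hq1 n
    nlinarith
  have hqmono : StrictMono q := strictMono_nat_of_lt_succ hqlt
  have hMq : ∀ n, M (q n) ≤ q (n + 1) := by
    intro n
    rw [hqs]
    have h1 := hM1 (q n)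
    have h2 := hq1 n
    nlinarith
  have hq2 : ∀ n, (2:ℝ) ^ n ≤ q n := by
    intro n
    induction n with
    | zero => simpa using hqp 0
    | succ n ih =>
      rw [hqs, pow_succ]
      push_cast
      nlinarith [hMp (q n), hqp n]
  have hqinv : ∀ n, 1 / (q n : ℝ) ≤ (1 / 2) ^ n := by
    intro n
    rw [one_div_pow]
    exact one_div_le_one_div_of_le (by positivity) (hq2 n)
  -- bounds on the coefficients
  have hA : ∀ n, a (q n) * Real.exp (q n) * (q n : ℝ) ^ 2 ≤ Ψ 1 := by
    intro n
    have h := haε (q n)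
    rw [le_div_iff₀ (by positivity)] at h
    have h3 : a (q n) * (q n : ℝ) ^ 2 ≤ Ψ 1 * Real.exp (-(q n)) := by nlinarith [ha0 (q n)]
    have h4 := mul_le_mul_of_nonneg_right h3 (Real.exp_pos (q n)).le
    rw [mul_assoc (Ψ 1), ← Real.exp_add, neg_add_cancel, Real.exp_zero, mul_one] at h4
    linarith
  have hAe : ∀ n, a (q n) * Real.exp (q n) * (q n : ℝ) ≤ Ψ 1 * (1 / 2) ^ n := by
    intro n
    have h := hA n
    have h1 := hqp n
    calc a (q n) * Real.exp (q n) * (q n : ℝ)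
        = a (q n) * Real.exp (q n) * (q n : ℝ) ^ 2 * (1 / q n) := by field_simp
      _ ≤ Ψ 1 * (1 / q n) := by gcongr
      _ ≤ _ := by gcongr; exact hqinv n
  have hAu : ∀ n, a (q n) * Real.exp (q n) ≤ Ψ 1 * (1 / 2) ^ n := by
    intro n
    refine le_trans ?_ (hAe n)
    exact le_mul_of_one_le_right (mul_nonneg (ha0 _).le (Real.exp_pos _).le) (hqp n)
  have hAq : ∀ n, a (q n) * (q n : ℝ) ≤ Ψ 1 * (1 / 2) ^ n := by
    intro n
    refine le_trans ?_ (hAe n)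
    have h1 : 1 ≤ Real.exp (q n) := Real.one_le_exp (by linarith [hqp n])
    have := ha0 (q n)
    have := hqp n
    gcongr
    exact le_mul_of_one_le_right (ha0 _).le h1
  have hA1 : ∀ n, a (q n) ≤ Ψ 1 * (1 / 2) ^ n := fun n =>
    (le_mul_of_one_le_right (ha0 _).le (hqp n)).trans (hAq n)
  have hgeo : Summable fun n : ℕ => Ψ 1 * (1 / 2) ^ n := summable_geometric_two.mul_left _
  obtain ⟨F, hFa, hFp, hFi, hFd⟩ := series_props q (fun n => a (q n)) _ hq1 (fun n => ha0 _) hgeo hAu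
  obtain ⟨α, hα⟩ := exists_alpha q (fun n => 16 * M (q n)) hq1
    (fun n => by have := hM1 (q n); omega) hqs
  refine ⟨F, α, hFa, hFp, hFi, ?_⟩
  let D : ℕ → ℕ → ℝ → ℝ := fun m N x =>
    ∑ k ∈ Finset.range N, Real.cos (2 * Real.pi * q m * (x + k * α))
  have hW : ∀ N x, HasSum (fun m => a (q m) * D m N x)
      (∑ k ∈ Finset.range N, deriv F (x + k * α)) := by
    intro N x
    have := hasSum_sum (s := Finset.range N) (fun k _ => hFd (x + k * α))
    simpa only [D, Finset.mul_sum] using this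
  have hD1 : ∀ m N x, |D m N x| ≤ N := by
    intro m N x
    refine (Finset.abs_sum_le_sum_abs _ _).trans ?_
    refine (Finset.sum_le_sum fun k _ => Real.abs_cos_le_one _).trans ?_
    simp
  have hD2 : ∀ m N x, |D m N x| ≤ 8 * M (q m) := by
    intro m N x
    obtain ⟨p, θ, h1, h2, h3⟩ := hα m
    have := dirichlet_bound N (16 * M (q m)) (by have := hM1 (q m); omega) (2 * Real.pi * q m * x)
      (q m * α) θ p h1 h2 h3
    have e : ∀ k : ℕ, 2 * Real.pi * q m * x + k * (2 * Real.pi * (q m * α)) =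
      2 * Real.pi * q m * (x + k * α) := fun k => by ring
    simp only [e] at this
    refine this.trans (le_of_eq ?_)
    push_cast; ring
  have hAD : ∀ m N x, |a (q m) * D m N x| = a (q m) * |D m N x| := fun m N x => by
    rw [abs_mul, abs_of_pos (ha0 _)]
  -- three kinds of bounds
  have hT1 : ∀ m N x, N ≤ q m → |a (q m) * D m N x| ≤ Ψ 1 * (1 / 2) ^ m := by
    intro m N x h
    rw [hAD]
    refine le_trans ?_ (hAq m)
    have h1 : (N:ℝ) ≤ q m := by exact_mod_cast h
    exact mul_le_mul_of_nonneg_left ((hD1 m N x).trans h1) (ha0 _).le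
  have hT2 : ∀ m N x, |a (q m) * D m N x| ≤ 8 * (Ψ 1 * (1 / 2) ^ m * q (m + 1)) := by
    intro m N x
    rw [hAD]
    have h1 : (M (q m) : ℝ) ≤ q (m + 1) := by exact_mod_cast hMq m
    calc a (q m) * |D m N x| ≤ a (q m) * (8 * M (q m)) :=
          mul_le_mul_of_nonneg_left (hD2 m N x) (ha0 _).le
      _ ≤ (Ψ 1 * (1 / 2) ^ m) * (8 * q (m + 1)) := by
          gcongr
          exact hA1 m
      _ = _ := by ring
  have hT3 : ∀ m N x, 1 ≤ N → |a (q m) * D m N x| ≤ 8 * Ψ N := by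
    intro m N x hN
    rw [hAD]
    have hN' : (0:ℝ) < N := by exact_mod_cast hN
    have hp := hΨpos N hN'
    rcases le_total N (M (q m)) with h | h
    · have h1 := haN (q m) N hN h
      have := mul_le_mul_of_nonneg_left (hD1 m N x) (ha0 (q m)).le
      linarith
    · have h1 := haN (q m) (M (q m)) (hM1 _) le_rfl
      have h2 : Ψ (M (q m)) ≤ Ψ N := hΨmono (by exact_mod_cast h)
      have := mul_le_mul_of_nonneg_left (hD2 m N x) (ha0 (q m)).le
      linarith
  have hgeo2 : HasSum (fun n : ℕ => ((1:ℝ) / 2) ^ n) 2 := hasSum_geometric_two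
  -- the upper bound
  have hup : ∀ N : ℕ, 1 ≤ N → ∀ x, ∑ k ∈ Finset.range N, deriv F (x + k * α) ≤ 32 * Ψ N := by
    intro N hN x
    have hN' : (0:ℝ) < N := by exact_mod_cast hN
    have hp := hΨpos N hN'
    have h1N : Ψ 1 ≤ Ψ N := hΨmono (by exact_mod_cast hN)
    have hex : ∃ j, N < q j := ⟨N, by
      have := hq2 N
      have h2 : N < 2 ^ N := Nat.lt_two_pow_self
      have h3 : 2 ^ N ≤ q N := by exact_mod_cast this
      omega⟩
    classical
    obtain ⟨n, hn⟩ : ∃ n, q n ≤ N ∧ N < q (n + 1) := by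
      have hs := Nat.find_spec hex
      have hj : Nat.find hex ≠ 0 := by
        intro h0
        rw [h0] at hs
        omega
      obtain ⟨n, hn⟩ := Nat.exists_eq_succ_of_ne_zero hj
      refine ⟨n, ?_, ?_⟩
      · exact not_lt.1 (Nat.find_min hex (by omega))
      · rw [hn] at hs; exact hs
    have hbd : ∀ m, a (q m) * D m N x ≤
        8 * Ψ N * ((1 / 2) ^ m + ((if m = n then 1 else 0) + (if m = n - 1 then 1 else 0))) := by
      intro m
      refine (le_abs_self _).trans ?_
      have hpw : (0:ℝ) < (1 / 2) ^ m := by positivity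
      have hi1 : (0:ℝ) ≤ if m = n then 1 else 0 := by split_ifs <;> norm_num
      have hi2 : (0:ℝ) ≤ if m = n - 1 then 1 else 0 := by split_ifs <;> norm_num
      by_cases hm : m = n ∨ m = n - 1
      · have h1 : (1:ℝ) ≤ (if m = n then 1 else 0) + (if m = n - 1 then 1 else 0) := by
          rcases hm with h | h
          · rw [if_pos h]; linarith
          · rw [if_pos h]; linarith
        have := hT3 m N x hN
        nlinarith
      · have key : |a (q m) * D m N x| ≤ 8 * Ψ N * (1 / 2) ^ m := by
          push Not at hm
          rcases lt_or_gt_of_ne hm.1 with h | h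
          · have h2 := hT2 m N x
            have h3 : Ψ 1 * q (m + 1) ≤ Ψ N := by
              have e1 := hK (q (m + 1))
              have e2 : M (q (m + 1)) ≤ N :=
                (hMq (m + 1)).trans ((hqmono.monotone (by omega : m + 1 + 1 ≤ n)).trans hn.1)
              have e3 : Ψ (M (q (m + 1))) ≤ Ψ N := hΨmono (by exact_mod_cast e2)
              nlinarith [hqp (m + 1)]
            nlinarith
          · have h2 := hT1 m N x (hn.2.le.trans (hqmono.monotone (by omega : n + 1 ≤ m)))
            nlinarith
        nlinarith [mul_nonneg hp.le hi1, mul_nonneg hp.le hi2]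
    have hs := (hgeo2.add ((hasSum_ite_eq n (1:ℝ)).add (hasSum_ite_eq (n - 1) (1:ℝ)))).mul_left (8 * Ψ N)
    have := hasSum_le hbd (hW N x) hs
    linarith
  -- the lower bound
  have hlow : ∀ n, 1 / 8 * Ψ (M (q n)) ≤
      ∑ k ∈ Finset.range (M (q n)), deriv F (0 + k * α) := by
    intro n
    have hmain : M (q n) * (1 / 2) ≤ D n (M (q n)) 0 := by
      obtain ⟨p, θ, h1, h2, h3⟩ := hα n
      have hc : ∀ k ∈ Finset.range (M (q n)), (1:ℝ) / 2 ≤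
          Real.cos (2 * Real.pi * q n * (0 + k * α)) := by
        intro k hk
        have hk' : (k:ℝ) ≤ M (q n) := by exact_mod_cast (Finset.mem_range.1 hk).le
        rw [show 2 * Real.pi * q n * (0 + k * α) = k * (2 * Real.pi * (q n * α)) by ring, h1,
          show (k:ℝ) * (2 * Real.pi * (p + θ)) = 2 * Real.pi * (k * θ) +
            ((k * p : ℤ) : ℝ) * (2 * Real.pi) by push_cast; ring, Real.cos_add_int_mul_two_pi,
          ← Real.cos_pi_div_three]
        have hθ0 : 0 ≤ θ := le_trans (by positivity) h2
        have hkθ : k * θ ≤ 1 / 8 := by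
          have := hMp (q n)
          calc k * θ ≤ M (q n) * (2 / ((16 * M (q n) : ℕ) : ℝ)) := by gcongr
            _ = 1 / 8 := by push_cast; field_simp; norm_num
        have hπ := Real.pi_pos
        apply Real.cos_le_cos_of_nonneg_of_le_pi
        · positivity
        · linarith
        · nlinarith
      have := Finset.sum_le_sum hc
      simpa [D] using this
    have hoff : ∀ m, m ≠ n → -(8 * Ψ 1 * q n * (1 / 2) ^ m) ≤ a (q m) * D m (M (q n)) 0 := by
      intro m hm
      refine le_trans (neg_le_neg ?_) (neg_abs_le _)
      have hpw : (0:ℝ) < (1 / 2) ^ m := by positivity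
      rcases lt_or_gt_of_ne hm with h | h
      · refine (hT2 m _ 0).trans ?_
        have h1 : (q (m + 1) : ℝ) ≤ q n := by exact_mod_cast hqmono.monotone (by omega : m + 1 ≤ n)
        have := mul_le_mul_of_nonneg_left h1 (mul_pos hc hpw).le
        linarith
      · refine (hT1 m _ 0 ((hMq n).trans (hqmono.monotone (by omega : n + 1 ≤ m)))).trans ?_
        have := mul_le_mul_of_nonneg_left (hqp n) (mul_pos hc hpw).le
        nlinarith [mul_pos hc hpw]
    have hall : ∀ m, -(8 * Ψ 1 * q n) * (1 / 2) ^ m + (if m = n then a (q n) * (M (q n) * (1 / 2)) else 0)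
        ≤ a (q m) * D m (M (q n)) 0 := by
      intro m
      by_cases hm : m = n
      · subst hm
        rw [if_pos rfl]
        have h1 := mul_le_mul_of_nonneg_left hmain (ha0 (q m)).le
        have h2 : 0 ≤ (8 * Ψ 1 * q m) * (1 / 2) ^ m := by positivity
        linarith
      · rw [if_neg hm]
        have := hoff m hm
        linarith
    have hs := (hgeo2.mul_left (-(8 * Ψ 1 * q n))).add
      (hasSum_ite_eq n (a (q n) * (M (q n) * (1 / 2))))
    have h1 := hasSum_le hall hs (hW (M (q n)) 0)
    have h2 := hΨM (q n)
    have h3 := hK (q n)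
    have : 0 ≤ Ψ 1 * q n := by positivity
    linarith
  have hMt : Tendsto (fun n => M (q n)) atTop atTop := by
    have h1 : Tendsto (fun n => Ψ (M (q n))) atTop atTop := by
      refine tendsto_atTop_mono (fun n => hK (q n)) ?_
      exact (tendsto_natCast_atTop_atTop.comp hqmono.tendsto_atTop).const_mul_atTop (by positivity)
    rw [tendsto_atTop]
    intro R
    filter_upwards [h1.eventually_gt_atTop (Ψ R)] with n hn
    by_contra hcon
    have : Ψ (M (q n)) ≤ Ψ R := hΨmono (by exact_mod_cast (not_le.1 hcon).le)
    linarith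
  haveI : Nonempty (Set.Ico (0:ℝ) 1) := ⟨⟨0, by norm_num⟩⟩
  constructor
  · refine lt_of_lt_of_le (b := ((1 / 8 : ℝ) : EReal)) (by exact_mod_cast (by norm_num : (0:ℝ) < 1 / 8)) ?_
    apply le_limsup_of_frequently_le
    · refine hMt.frequently (Eventually.frequently (Eventually.of_forall fun n => ?_))
      have hp := hΨpos (M (q n)) (by have := hMp (q n); linarith)
      rw [EReal.coe_le_coe_iff, le_div_iff₀ hp]
      refine (hlow n).trans ?_
      refine le_ciSup (f := fun x : Set.Ico (0:ℝ) 1 =>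
        ∑ k ∈ Finset.range (M (q n)), deriv F ((x:ℝ) + k * α)) ?_ (⟨0, by norm_num⟩ : Set.Ico (0:ℝ) 1)
      refine ⟨32 * Ψ (M (q n)), ?_⟩
      rintro _ ⟨x, rfl⟩
      exact hup _ (hM1 _) x
    · isBoundedDefault
  · refine lt_of_le_of_lt (b := ((32 : ℝ) : EReal)) ?_ (EReal.coe_lt_top _)
    apply limsup_le_of_le
    · isBoundedDefault
    · filter_upwards [eventually_ge_atTop 1] with N hN
      have hp := hΨpos N (by exact_mod_cast hN)
      rw [EReal.coe_le_coe_iff, div_le_iff₀ hp]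
      exact ciSup_le fun x => hup N hN x
end

section
/- Let Ψ be admissible. Then there exists a smooth diffeomorphism f of ℝ² preserving Lebesgue measure, satisfying f(x + p, y + q) = f(x, y) + (p, q) for all integers p, q (so f descends to an area-preserving diffeomorphism of the torus 𝕋² = ℝ²/ℤ²), such that 0 < limsup_{n→∞} Γ_n(f) / Ψ(n) < ∞, where Γ_n(f) = max( sup_{(x,y)} ‖D_{(x,y)} f^n‖ , sup_{(x,y)} ‖D_{(x,y)} f^{−n}‖ ). -/
open Filter MeasureTheory

/-- The skew shift `(x, y) ↦ (x + β, y + u x)`. -/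
def skewShift (β : ℝ) (u : ℝ → ℝ) (z : ℝ × ℝ) : ℝ × ℝ := (z.1 + β, z.2 + u z.1)

theorem skewShift_iterate (β : ℝ) (u : ℝ → ℝ) (n : ℕ) (z : ℝ × ℝ) :
    (skewShift β u)^[n] z = (z.1 + n * β, z.2 + ∑ i ∈ Finset.range n, u (z.1 + i * β)) := by
  induction n with
  | zero => simp
  | succ n ih =>
    rw [Function.iterate_succ_apply', ih, Finset.sum_range_succ]
    simp only [skewShift]
    push_cast
    ext <;> simp <;> ring

theorem skewShift_contDiff (β : ℝ) (u : ℝ → ℝ) (hu : ContDiff ℝ (⊤ : ℕ∞) u) :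
    ContDiff ℝ (⊤ : ℕ∞) (skewShift β u) := by
  unfold skewShift
  fun_prop

theorem skewShift_fderiv (β : ℝ) (u u' : ℝ → ℝ) (hu : ∀ x, HasDerivAt u (u' x) x)
    (n : ℕ) (z : ℝ × ℝ) :
    fderiv ℝ ((skewShift β u)^[n]) z =
      (ContinuousLinearMap.fst ℝ ℝ ℝ).prod (ContinuousLinearMap.snd ℝ ℝ ℝ +
        (∑ i ∈ Finset.range n, u' (z.1 + i * β)) • ContinuousLinearMap.fst ℝ ℝ ℝ) := by
  have h1 : (skewShift β u)^[n] = fun z : ℝ × ℝ =>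
      (z.1 + n * β, z.2 + ∑ i ∈ Finset.range n, u (z.1 + i * β)) := by
    funext z; exact skewShift_iterate β u n z
  rw [h1]
  have hf : HasFDerivAt (fun z : ℝ × ℝ => z.1) (ContinuousLinearMap.fst ℝ ℝ ℝ) z := hasFDerivAt_fst
  have hs : HasFDerivAt (fun z : ℝ × ℝ => z.2) (ContinuousLinearMap.snd ℝ ℝ ℝ) z := hasFDerivAt_snd
  have hsum : HasDerivAt (fun x : ℝ => ∑ i ∈ Finset.range n, u (x + i * β))
      (∑ i ∈ Finset.range n, u' (z.1 + i * β)) z.1 := by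
    apply HasDerivAt.fun_sum
    intro i _
    exact (hu (z.1 + i * β)).comp_add_const z.1 (i * β)
  exact ((hf.add_const _).prodMk (hs.add (hsum.comp_hasFDerivAt z hf))).fderiv

theorem skewShift_norm_le (d : ℝ) :
    ‖(ContinuousLinearMap.fst ℝ ℝ ℝ).prod (ContinuousLinearMap.snd ℝ ℝ ℝ +
        d • ContinuousLinearMap.fst ℝ ℝ ℝ)‖ ≤ 1 + |d| := by
  apply ContinuousLinearMap.opNorm_le_bound _ (by positivity)
  intro z
  have h1 : |z.1| ≤ ‖z‖ := norm_fst_le z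
  have h2 : |z.2| ≤ ‖z‖ := norm_snd_le z
  have h0 := norm_nonneg z
  have hd := abs_nonneg d
  rw [Prod.norm_def]
  simp only [ContinuousLinearMap.prod_apply, add_apply,
    smul_apply, ContinuousLinearMap.coe_fst', ContinuousLinearMap.coe_snd',
    smul_eq_mul, Real.norm_eq_abs]
  apply max_le
  · nlinarith
  · calc |z.2 + d * z.1| ≤ |z.2| + |d * z.1| := abs_add_le _ _
      _ = |z.2| + |d| * |z.1| := by rw [abs_mul]
      _ ≤ _ := by nlinarith

theorem skewShift_le_norm (d : ℝ) :
    |d| ≤ ‖(ContinuousLinearMap.fst ℝ ℝ ℝ).prod (ContinuousLinearMap.snd ℝ ℝ ℝ +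
        d • ContinuousLinearMap.fst ℝ ℝ ℝ)‖ := by
  have h := ContinuousLinearMap.le_opNorm ((ContinuousLinearMap.fst ℝ ℝ ℝ).prod
    (ContinuousLinearMap.snd ℝ ℝ ℝ + d • ContinuousLinearMap.fst ℝ ℝ ℝ)) ((1, 0) : ℝ × ℝ)
  have h1 : ‖((1, 0) : ℝ × ℝ)‖ = 1 := by simp [Prod.norm_def]
  rw [h1, mul_one] at h
  refine le_trans ?_ h
  refine le_trans ?_ (norm_snd_le _)
  simp

theorem dynamics_reduction (Ψ : ℝ → ℝ) (hΨpos : ∀ x > 0, 0 < Ψ x)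
    (hΨunbdd : Tendsto Ψ atTop atTop) (α : ℝ) (φ ψ : ℝ → ℝ)
    (hφ : ContDiff ℝ (⊤ : ℕ∞) φ) (hψ : ∀ x, HasDerivAt φ (ψ x) x)
    (hper : ∀ (x : ℝ) (p : ℤ), φ (x + p) = φ x)
    (hup : ∀ n : ℕ, 1 ≤ n → ∀ x : ℝ, |∑ i ∈ Finset.range n, ψ (x + i * α)| ≤ 7 * Ψ n)
    (hlow : ∃ᶠ n : ℕ in atTop, Ψ n / 4 ≤ |∑ i ∈ Finset.range n, ψ (0 + i * α)|) :
    ∃ f g : ℝ × ℝ → ℝ × ℝ,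
      ContDiff ℝ (⊤ : ℕ∞) f ∧ ContDiff ℝ (⊤ : ℕ∞) g ∧
      Function.LeftInverse g f ∧ Function.RightInverse g f ∧
      MeasurePreserving f volume volume ∧
      (∀ (x y : ℝ) (p q : ℤ),
        f (x + p, y + q) = ((f (x, y)).1 + p, (f (x, y)).2 + q)) ∧
      0 < Filter.limsup
          (fun n : ℕ =>
            (((max (⨆ z : ℝ × ℝ, ‖fderiv ℝ (f^[n]) z‖)
                   (⨆ z : ℝ × ℝ, ‖fderiv ℝ (g^[n]) z‖))
              / Ψ n : ℝ) : EReal))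
          atTop ∧
      Filter.limsup
          (fun n : ℕ =>
            (((max (⨆ z : ℝ × ℝ, ‖fderiv ℝ (f^[n]) z‖)
                   (⨆ z : ℝ × ℝ, ‖fderiv ℝ (g^[n]) z‖))
              / Ψ n : ℝ) : EReal))
          atTop < ⊤ := by
  set v : ℝ → ℝ := fun x => -φ (x + -α) with hv
  set v' : ℝ → ℝ := fun x => -ψ (x + -α) with hv'
  have hvd : ∀ x, HasDerivAt v (v' x) x := fun x =>
    ((hψ (x + -α)).comp_add_const x (-α)).neg
  have hbf : ∀ n : ℕ, 1 ≤ n → ∀ z : ℝ × ℝ,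
      ‖fderiv ℝ ((skewShift α φ)^[n]) z‖ ≤ 1 + 7 * Ψ n := by
    intro n hn z
    rw [skewShift_fderiv α φ ψ hψ]
    refine (skewShift_norm_le _).trans ?_
    linarith [hup n hn z.1]
  have hbg : ∀ n : ℕ, 1 ≤ n → ∀ z : ℝ × ℝ,
      ‖fderiv ℝ ((skewShift (-α) v)^[n]) z‖ ≤ 1 + 7 * Ψ n := by
    intro n hn z
    rw [skewShift_fderiv (-α) v v' hvd]
    refine (skewShift_norm_le _).trans ?_
    have h := hup n hn (z.1 - n * α)
    have h2 : ∑ i ∈ Finset.range n, v' (z.1 + i * -α) =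
        -∑ i ∈ Finset.range n, ψ (z.1 - n * α + i * α) := by
      rw [← Finset.sum_range_reflect, ← Finset.sum_neg_distrib]
      apply Finset.sum_congr rfl
      intro i hi
      have hi' : i < n := Finset.mem_range.mp hi
      have h3 : ((n - 1 - i : ℕ) : ℝ) = n - 1 - i := by
        have : n - 1 - i + (i + 1) = n := by omega
        have h4 : ((n - 1 - i + (i + 1) : ℕ) : ℝ) = n := by rw [this]
        push_cast at h4 ⊢
        linarith
      simp only [hv', h3]
      congr 2
      ring
    rw [h2, abs_neg]
    linarith
  refine ⟨skewShift α φ, skewShift (-α) v, skewShift_contDiff _ _ hφ,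
    skewShift_contDiff _ _ (by rw [hv]; fun_prop), ?_, ?_, ?_, ?_, ?_, ?_⟩
  · intro z
    ext <;> simp [skewShift, hv]
  · intro z
    ext <;> simp [skewShift, hv]
  · have h := MeasurePreserving.skew_product (μa := (volume : Measure ℝ)) (μb := volume)
      (μc := (volume : Measure ℝ)) (μd := volume) (f := fun x : ℝ => x + α)
      (measurePreserving_add_right volume α) (g := fun x y => y + φ x)
      (by
        have := hφ.continuous
        apply Continuous.measurable
        unfold Function.uncurry
        fun_prop)
      (by
        refine Eventually.of_forall fun a => ?_
        exact (measurePreserving_add_right volume (φ a)).map_eq)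
    exact h
  · intro x y p q
    simp only [skewShift, hper]
    ext <;> simp <;> ring
  · refine lt_of_lt_of_le (b := ((1 / 4 : ℝ) : EReal)) (by exact_mod_cast (by norm_num)) ?_
    refine le_limsup_of_frequently_le ?_
    refine (hlow.and_eventually (eventually_ge_atTop 1)).mono ?_
    rintro n ⟨h, hn⟩
    have hpos : 0 < Ψ n := hΨpos _ (by exact_mod_cast hn)
    rw [EReal.coe_le_coe_iff, le_div_iff₀ hpos]
    refine le_trans ?_ (le_max_left _ _)
    have hb : BddAbove (Set.range fun z : ℝ × ℝ => ‖fderiv ℝ ((skewShift α φ)^[n]) z‖) := by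
      refine ⟨1 + 7 * Ψ n, ?_⟩
      rintro _ ⟨z, rfl⟩
      exact hbf n hn z
    refine le_trans ?_ (le_ciSup hb (0, 0))
    rw [skewShift_fderiv α φ ψ hψ]
    refine le_trans ?_ (skewShift_le_norm _)
    simp only
    linarith
  · refine lt_of_le_of_lt (b := ((8 : ℝ) : EReal)) ?_ (EReal.coe_lt_top _)
    refine limsup_le_of_le (by isBoundedDefault) ?_
    have h1 : ∀ᶠ n : ℕ in atTop, 1 ≤ Ψ n :=
      (hΨunbdd.comp tendsto_natCast_atTop_atTop).eventually (eventually_ge_atTop 1)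
    filter_upwards [h1, eventually_ge_atTop 1] with n h hn
    rw [EReal.coe_le_coe_iff, div_le_iff₀ (by linarith)]
    apply max_le
    · exact ciSup_le fun z => (hbf n hn z).trans (by linarith)
    · exact ciSup_le fun z => (hbg n hn z).trans (by linarith)

/-- Record points of `Ψ n / n`. -/
def IsRecord (Ψ : ℝ → ℝ) (N : ℕ) : Prop := ∀ m : ℕ, 1 ≤ m → m ≤ N → Ψ N / N ≤ Ψ m / m

theorem exists_record (Ψ : ℝ → ℝ)
    (hΨpos : ∀ x > 0, 0 < Ψ x)
    (hΨmono : Monotone Ψ)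
    (hΨunbdd : Tendsto Ψ atTop atTop)
    (hΨo : Ψ =o[atTop] fun x => x) (ε B : ℝ) (hε : 0 < ε) :
    ∃ N : ℕ, 0 < N ∧ IsRecord Ψ N ∧ Ψ N / N ≤ ε ∧ B ≤ Ψ N := by
  obtain ⟨M, hMB, hM1⟩ : ∃ M : ℕ, B ≤ Ψ M ∧ 1 ≤ M :=
    (((hΨunbdd.comp tendsto_natCast_atTop_atTop).eventually (eventually_ge_atTop B)).and
      (eventually_ge_atTop 1)).exists
  have hM0 : (0 : ℝ) < M := by exact_mod_cast hM1
  have h1 : 0 < Ψ 1 := hΨpos 1 one_pos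
  have hε' : 0 < min ε (Ψ 1 / M) := lt_min hε (by positivity)
  set e := min ε (Ψ 1 / M)
  have hlim : Tendsto (fun n : ℕ => Ψ n / n) atTop (nhds 0) :=
    hΨo.tendsto_div_nhds_zero.comp tendsto_natCast_atTop_atTop
  have hex : ∃ n : ℕ, 1 ≤ n ∧ Ψ n / n < e :=
    ((eventually_ge_atTop 1).and (hlim.eventually (gt_mem_nhds hε'))).exists
  classical
  obtain ⟨hN1, hN2⟩ := Nat.find_spec hex
  have hmin : ∀ m < Nat.find hex, ¬ (1 ≤ m ∧ Ψ m / m < e) := fun m hm => Nat.find_min hex hm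
  set N := Nat.find hex
  have hN0 : (0 : ℝ) < N := by exact_mod_cast hN1
  refine ⟨N, hN1, ?_, hN2.le.trans (min_le_left _ _), ?_⟩
  · intro m hm hmN
    rcases hmN.eq_or_lt with h | h
    · rw [h]
    · have := hmin m h
      push Not at this
      exact hN2.le.trans (this hm)
  · refine hMB.trans (hΨmono ?_)
    have h2 : Ψ N / N < Ψ 1 / M := hN2.trans_le (min_le_right _ _)
    have h3 : Ψ 1 ≤ Ψ N := hΨmono (by exact_mod_cast hN1)
    rw [div_lt_div_iff₀ hN0 hM0] at h2
    by_contra! hlt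
    nlinarith

theorem exists_sequences (Ψ : ℝ → ℝ)
    (hΨpos : ∀ x > 0, 0 < Ψ x)
    (hΨmono : Monotone Ψ)
    (hΨunbdd : Tendsto Ψ atTop atTop)
    (hΨo : Ψ =o[atTop] fun x => x) :
    ∃ q N : ℕ → ℕ, (∀ k, 0 < q k) ∧ (∀ k, 0 < N k) ∧ (∀ k, IsRecord Ψ (N k)) ∧
      (∀ k, q (k + 1) = q k * (8 * N k)) ∧
      (∀ k, Ψ (N (k + 1)) / N (k + 1) ≤ (Ψ (N k) / N k) / 2) ∧
      (∀ k, 17 * Ψ (N k) ≤ Ψ (N (k + 1))) ∧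
      (∀ k, 1 ≤ k → Ψ (N k) / N k * (7 * q k) ^ k ≤ (1 / 2) ^ k) := by
  let S := {p : ℕ × ℕ // 0 < p.1 ∧ 0 < p.2 ∧ IsRecord Ψ p.2}
  have step : ∀ (k : ℕ) (p : S), ∃ p' : S, p'.1.1 = p.1.1 * (8 * p.1.2) ∧
      Ψ p'.1.2 / p'.1.2 ≤ (Ψ p.1.2 / p.1.2) / 2 ∧ 17 * Ψ p.1.2 ≤ Ψ p'.1.2 ∧
      Ψ p'.1.2 / p'.1.2 * (7 * p'.1.1) ^ (k + 1) ≤ (1 / 2) ^ (k + 1) := by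
    rintro k ⟨⟨q, N⟩, hq, hN, hr⟩
    simp only at hq hN hr
    have hN0 : (0 : ℝ) < N := by exact_mod_cast hN
    have hq0 : 0 < q * (8 * N) := by positivity
    have hq0' : (0 : ℝ) < ((q * (8 * N) : ℕ) : ℝ) := by exact_mod_cast hq0
    have hp := hΨpos N hN0
    obtain ⟨N', h1, h2, h3, h4⟩ := exists_record Ψ hΨpos hΨmono hΨunbdd hΨo
      (min ((Ψ N / N) / 2) ((1 / 2) ^ (k + 1) / (7 * ((q * (8 * N) : ℕ) : ℝ)) ^ (k + 1)))
      (17 * Ψ N) (lt_min (by positivity) (by positivity))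
    refine ⟨⟨⟨q * (8 * N), N'⟩, hq0, h1, h2⟩, rfl, h3.trans (min_le_left _ _), h4, ?_⟩
    have := h3.trans (min_le_right _ _)
    rwa [le_div_iff₀ (by positivity)] at this
  choose F hF using step
  let p : ℕ → S := fun n => Nat.rec ⟨(1, 1), one_pos, one_pos, by
    intro m hm hm1
    have : m = 1 := le_antisymm hm1 hm
    rw [this]⟩ F n
  have hp : ∀ k, p (k + 1) = F k (p k) := fun k => rfl
  refine ⟨fun k => (p k).1.1, fun k => (p k).1.2, fun k => (p k).2.1, fun k => (p k).2.2.1,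
    fun k => (p k).2.2.2, fun k => ?_, fun k => ?_, fun k => ?_, fun k hk => ?_⟩
  · simp only [hp]; exact (hF k (p k)).1
  · simp only [hp]; exact (hF k (p k)).2.1
  · simp only [hp]; exact (hF k (p k)).2.2.1
  · obtain ⟨j, rfl⟩ : ∃ j, k = j + 1 := ⟨k - 1, by omega⟩
    simp only [hp]; exact (hF j (p j)).2.2.2

theorem rotation_number (q N : ℕ → ℕ) (hq : ∀ k, 0 < q k) (hN : ∀ k, 0 < N k)
    (hqN : ∀ k, q (k + 1) = q k * (8 * N k)) :
    ∃ α : ℝ, ∀ k, ∃ (m : ℤ) (δ : ℝ), q k * α = m + δ ∧ 1 / (8 * N k) ≤ δ ∧ δ ≤ 1 / (7 * N k) := by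
  have hqr : ∀ k, (0 : ℝ) < q k := fun k => by exact_mod_cast hq k
  have hNr : ∀ k, (0 : ℝ) < N k := fun k => by exact_mod_cast hN k
  have hgrow : ∀ k i, (1 : ℝ) / q (i + k) ≤ 1 / q k * (1 / 8) ^ i := by
    intro k i
    induction i with
    | zero => simp
    | succ i ih =>
      have h1 : (8 : ℝ) * q (i + k) ≤ q (i + 1 + k) := by
        have : 8 * q (i + k) ≤ q (i + 1 + k) := by
          rw [show i + 1 + k = (i + k) + 1 by ring, hqN]
          nlinarith [hq (i + k), hN (i + k), Nat.mul_le_mul_left (q (i + k)) (hN (i + k))]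
        exact_mod_cast this
      calc (1 : ℝ) / q (i + 1 + k) ≤ 1 / (8 * q (i + k)) :=
            one_div_le_one_div_of_le (by have := hqr (i + k); positivity) h1
        _ = 1 / q (i + k) * (1 / 8) := by rw [one_div_mul_one_div]; ring
        _ ≤ (1 / q k * (1 / 8) ^ i) * (1 / 8) := by gcongr
        _ = _ := by ring
  have hgs : Summable (fun i : ℕ => ((1 : ℝ) / 8) ^ i) :=
    summable_geometric_of_lt_one (by norm_num) (by norm_num)
  have hs : Summable (fun j => (1 : ℝ) / q j) :=
    Summable.of_nonneg_of_le (fun j => by positivity) (fun j => hgrow 0 j)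
      (hgs.mul_left _)
  refine ⟨∑' j, (1 : ℝ) / q j, fun k => ?_⟩
  have hdvd : ∀ j k, j ≤ k → q j ∣ q k := by
    intro j k h
    induction k, h using Nat.le_induction with
    | base => exact dvd_rfl
    | succ k _ ih => rw [hqN]; exact ih.mul_right _
  have hs' : Summable (fun j => (1 : ℝ) / q (j + (k + 1))) :=
    (summable_nat_add_iff (k + 1)).mpr hs
  refine ⟨((∑ j ∈ Finset.range (k + 1), q k / q j : ℕ) : ℤ),
    q k * ∑' j, (1 : ℝ) / q (j + (k + 1)), ?_, ?_, ?_⟩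
  · rw [← hs.sum_add_tsum_nat_add (k + 1), mul_add, Finset.mul_sum]
    congr 1
    rw [Int.cast_natCast, Nat.cast_sum]
    apply Finset.sum_congr rfl
    intro j hj
    rw [Nat.cast_div (hdvd j k (by have := Finset.mem_range.mp hj; omega)) (hqr j).ne']
    ring
  · have h1 : (1 : ℝ) / q (0 + (k + 1)) ≤ ∑' j, (1 : ℝ) / q (j + (k + 1)) :=
      hs'.le_tsum 0 (fun j _ => by positivity)
    calc (1 : ℝ) / (8 * N k) = q k * (1 / q (0 + (k + 1))) := by
          rw [zero_add, hqN]; push_cast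
          have := hqr k; have := hNr k
          field_simp
      _ ≤ _ := mul_le_mul_of_nonneg_left h1 (hqr k).le
  · have h1 : ∑' j, (1 : ℝ) / q (j + (k + 1)) ≤ ∑' j : ℕ, 1 / q (k + 1) * (1 / 8 : ℝ) ^ j :=
      hs'.tsum_le_tsum (fun j => hgrow (k + 1) j) (hgs.mul_left _)
    rw [tsum_mul_left, tsum_geometric_of_lt_one (by norm_num) (by norm_num)] at h1
    refine (mul_le_mul_of_nonneg_left h1 (hqr k).le).trans (le_of_eq ?_)
    rw [hqN]; push_cast
    have := hqr k; have := hNr k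
    field_simp
    norm_num

theorem cos_sum_identity (θ η : ℝ) (n : ℕ) :
    2 * Real.sin (η / 2) * ∑ i ∈ Finset.range n, Real.cos (θ + i * η) =
      Real.sin (θ + n * η - η / 2) - Real.sin (θ - η / 2) := by
  induction n with
  | zero => simp
  | succ n ih =>
    rw [Finset.sum_range_succ, mul_add, ih]
    push_cast
    rw [show θ + (n + 1) * η - η / 2 = (θ + n * η) + η / 2 by ring, Real.sin_add, Real.sin_sub (θ + n * η)]
    ring

theorem cos_sum_bound (θ δ L : ℝ) (hL : 1 ≤ L) (h1 : 1 / (8 * L) ≤ δ) (h2 : δ ≤ 1 / (7 * L)) (n : ℕ) :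
    |∑ i ∈ Finset.range n, Real.cos (θ + i * (2 * Real.pi * δ))| ≤ 4 * L := by
  have hδ0 : 0 < δ := lt_of_lt_of_le (by positivity) h1
  have hδ1 : δ ≤ 1 / 2 := h2.trans (one_div_le_one_div_of_le (by norm_num) (by linarith))
  have hid := cos_sum_identity θ (2 * Real.pi * δ) n
  rw [show 2 * Real.pi * δ / 2 = Real.pi * δ by ring] at hid
  have hpi := Real.pi_pos
  have hsin : 2 * δ ≤ Real.sin (Real.pi * δ) := by
    have := Real.mul_le_sin (x := Real.pi * δ) (by positivity) (by nlinarith)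
    calc 2 * δ = 2 / Real.pi * (Real.pi * δ) := by field_simp
      _ ≤ _ := this
  set s := ∑ i ∈ Finset.range n, Real.cos (θ + i * (2 * Real.pi * δ))
  have habs : 2 * Real.sin (Real.pi * δ) * |s| ≤ 2 := by
    have h3 : |2 * Real.sin (Real.pi * δ) * s| ≤ 2 := by
      rw [hid, abs_le]
      constructor <;> linarith [Real.sin_le_one (θ + n * (2 * Real.pi * δ) - Real.pi * δ),
        Real.neg_one_le_sin (θ + n * (2 * Real.pi * δ) - Real.pi * δ),
        Real.sin_le_one (θ - Real.pi * δ), Real.neg_one_le_sin (θ - Real.pi * δ)]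
    rwa [abs_mul, abs_of_nonneg (by linarith)] at h3
  have h4 : 4 * δ * |s| ≤ 2 := by
    nlinarith [abs_nonneg s]
  rw [div_le_iff₀ (by positivity)] at h1
  have h5 : |s| ≤ |s| * (δ * (8 * L)) := by nlinarith [abs_nonneg s]
  nlinarith

theorem cos_sum_lower (δ : ℝ) (N n : ℕ) (hN : 0 < N) (hn : n ≤ N) (h0 : 0 ≤ δ)
    (h2 : δ ≤ 1 / (7 * N)) :
    (n : ℝ) / 2 ≤ ∑ i ∈ Finset.range n, Real.cos (0 + i * (2 * Real.pi * δ)) := by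
  have hN0 : (0 : ℝ) < N := by exact_mod_cast hN
  have hpi := Real.pi_pos
  have : ∑ i ∈ Finset.range n, (1 / 2 : ℝ) = n / 2 := by simp; ring
  rw [← this]
  apply Finset.sum_le_sum
  intro i hi
  have hi' : (i : ℝ) ≤ N := by
    have := Finset.mem_range.mp hi
    exact_mod_cast (by omega : i ≤ N)
  rw [← Real.cos_pi_div_three]
  have h3 : i * δ ≤ 1 / 7 := by
    calc i * δ ≤ N * (1 / (7 * N)) := by gcongr
      _ = 1 / 7 := by field_simp
  have h4 : 0 ≤ i * δ := by positivity
  apply Real.cos_le_cos_of_nonneg_of_le_pi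
  · rw [show (0 : ℝ) + i * (2 * Real.pi * δ) = 2 * Real.pi * (i * δ) by ring]; positivity
  · linarith
  · rw [show (0 : ℝ) + i * (2 * Real.pi * δ) = 2 * Real.pi * (i * δ) by ring]
    nlinarith

theorem slow_main (Ψ : ℝ → ℝ)
    (hΨpos : ∀ x > 0, 0 < Ψ x)
    (hΨmono : Monotone Ψ)
    (hΨunbdd : Tendsto Ψ atTop atTop)
    (hΨo : Ψ =o[atTop] fun x => x) :
    ∃ (α : ℝ) (φ ψ : ℝ → ℝ), ContDiff ℝ (⊤ : ℕ∞) φ ∧ (∀ x, HasDerivAt φ (ψ x) x) ∧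
    (∀ (x : ℝ) (p : ℤ), φ (x + p) = φ x) ∧
    (∀ n : ℕ, 1 ≤ n → ∀ x : ℝ, |∑ i ∈ Finset.range n, ψ (x + i * α)| ≤ 7 * Ψ n) ∧
    (∃ᶠ n : ℕ in atTop, Ψ n / 4 ≤ |∑ i ∈ Finset.range n, ψ (0 + i * α)|) := by
  obtain ⟨q, N, hq, hN, hrec, hqN, hc2, h17, hsm⟩ :=
    exists_sequences Ψ hΨpos hΨmono hΨunbdd hΨo
  obtain ⟨α, hα⟩ := rotation_number q N hq hN hqN
  choose m δ hm hδ1 hδ2 using hα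
  have hqr : ∀ k, (1 : ℝ) ≤ q k := fun k => by exact_mod_cast hq k
  have hNr : ∀ k, (1 : ℝ) ≤ N k := fun k => by exact_mod_cast hN k
  have hΨN : ∀ k, 0 < Ψ (N k) := fun k => hΨpos _ (by linarith [hNr k])
  have hδ0 : ∀ k, 0 ≤ δ k := fun k => le_trans (by positivity) (hδ1 k)
  obtain ⟨c, hc⟩ : ∃ c : ℕ → ℝ, c = fun k => Ψ (N k) / N k := ⟨_, rfl⟩
  obtain ⟨a, ha⟩ : ∃ a : ℕ → ℝ, a = fun k => 2 * Real.pi * q k := ⟨_, rfl⟩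
  have hc0 : ∀ k, 0 < c k := fun k => by
    rw [hc]; exact div_pos (hΨN k) (by linarith [hNr k])
  have hcN : ∀ k, c k * N k = Ψ (N k) := fun k => by
    have := hNr k
    rw [hc]; field_simp
  have hc2' : ∀ k, c (k + 1) ≤ c k / 2 := fun k => by rw [hc]; exact hc2 k
  have hpi3 := Real.pi_gt_three
  have hpi4 : Real.pi < 3.5 := by linarith [Real.pi_lt_d2]
  have ha1 : ∀ k, 1 ≤ a k := fun k => by rw [ha]; nlinarith [hqr k]
  have ha7 : ∀ k, a k ≤ 7 * q k := fun k => by rw [ha]; nlinarith [hqr k]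
  have hgeo : Summable (fun k : ℕ => (1 / 2 : ℝ) ^ k) := summable_geometric_two
  have hsum : ∀ s : ℕ, Summable (fun k => c k * a k ^ s) := by
    intro s
    apply Summable.of_norm_bounded_eventually_nat hgeo
    filter_upwards [eventually_ge_atTop s, eventually_ge_atTop 1] with k hk hk1
    have h0 := hc0 k
    have h1 := ha1 k
    rw [Real.norm_of_nonneg (by positivity)]
    calc c k * a k ^ s ≤ c k * a k ^ k := by gcongr
      _ ≤ c k * (7 * q k) ^ k := by gcongr; exact ha7 k
      _ ≤ _ := by rw [hc]; exact hsm k hk1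
  have hsc : Summable c := by simpa using hsum 0
  -- derivative sum rewriting
  have hterm : ∀ k n x, ∑ i ∈ Finset.range n, Real.cos (a k * (x + i * α)) =
      ∑ i ∈ Finset.range n, Real.cos (a k * x + i * (2 * Real.pi * δ k)) := by
    intro k n x
    apply Finset.sum_congr rfl
    intro i _
    have h : a k * (x + i * α) = a k * x + i * (2 * Real.pi * δ k) +
        ((i * m k : ℤ) : ℝ) * (2 * Real.pi) := by
      have := hm k
      rw [ha]
      push_cast
      linear_combination (2 * Real.pi * i) * this
    rw [h, Real.cos_add_int_mul_two_pi]
  have hcs : ∀ x, Summable (fun k => c k * Real.cos (a k * x)) := fun x =>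
    Summable.of_norm_bounded hsc (fun k => by
      rw [norm_mul, Real.norm_of_nonneg (hc0 k).le]
      exact mul_le_of_le_one_right (hc0 k).le (Real.abs_cos_le_one _))
  have hswap : ∀ (n : ℕ) x, ∑ i ∈ Finset.range n, ∑' k, c k * Real.cos (a k * (x + i * α)) =
      ∑' k, c k * ∑ i ∈ Finset.range n, Real.cos (a k * x + i * (2 * Real.pi * δ k)) := by
    intro n x
    rw [← Summable.tsum_finsetSum (fun i _ => hcs _)]
    congr 1
    funext k
    rw [← hterm, Finset.mul_sum]
  have hD1 : ∀ k n θ, |∑ i ∈ Finset.range n, Real.cos (θ + i * (2 * Real.pi * δ k))| ≤ (n : ℝ) := by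
    intro k n θ
    refine (Finset.abs_sum_le_sum_abs _ _).trans ?_
    refine (Finset.sum_le_sum (fun i _ => Real.abs_cos_le_one _)).trans ?_
    simp
  have hD2 : ∀ k n θ, |∑ i ∈ Finset.range n, Real.cos (θ + i * (2 * Real.pi * δ k))| ≤ 4 * (N k : ℝ) :=
    fun k n θ => cos_sum_bound θ (δ k) (N k) (hNr k) (hδ1 k) (hδ2 k) n
  have hsumD : ∀ (n : ℕ) x, Summable (fun k => c k *
      ∑ i ∈ Finset.range n, Real.cos (a k * x + i * (2 * Real.pi * δ k))) := by
    intro n x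
    apply Summable.of_norm_bounded (hsc.mul_right (n : ℝ))
    intro k
    rw [norm_mul, Real.norm_of_nonneg (hc0 k).le]
    exact mul_le_mul_of_nonneg_left (hD1 k n _) (hc0 k).le
  have hpre : ∀ k, ∑ j ∈ Finset.range k, Ψ (N j) ≤ Ψ (N k) / 16 := by
    intro k
    induction k with
    | zero => have := hΨN 0; rw [Finset.sum_range_zero]; positivity
    | succ k ih =>
      rw [Finset.sum_range_succ]
      linarith [h17 k]
  have hNmono : StrictMono N := by
    apply strictMono_nat_of_lt_succ
    intro k
    by_contra! h
    have h1 : Ψ (N (k + 1)) ≤ Ψ (N k) := hΨmono (by exact_mod_cast h)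
    linarith [h17 k, hΨN k]
  have hlowpart : ∀ k n x, |∑ j ∈ Finset.range k, c j *
      ∑ i ∈ Finset.range n, Real.cos (a j * x + i * (2 * Real.pi * δ j))| ≤
      4 * ∑ j ∈ Finset.range k, Ψ (N j) := by
    intro k n x
    refine (Finset.abs_sum_le_sum_abs _ _).trans ?_
    rw [Finset.mul_sum]
    apply Finset.sum_le_sum
    intro j _
    rw [abs_mul, abs_of_pos (hc0 j), ← hcN]
    calc _ ≤ c j * (4 * N j) := mul_le_mul_of_nonneg_left (hD2 j n _) (hc0 j).le
      _ = _ := by ring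
  refine ⟨α, fun x => ∑' k, c k / a k * Real.sin (a k * x),
    fun x => ∑' k, c k * Real.cos (a k * x), ?_, ?_, ?_, ?_, ?_⟩
  · apply contDiff_tsum (v := fun s k => c k * a k ^ s)
    · intro k
      fun_prop
    · intro s _
      exact hsum s
    · intro s k x _
      rw [norm_iteratedFDeriv_eq_norm_iteratedDeriv, iteratedDeriv_const_mul_field,
        iteratedDeriv_comp_const_mul (f := Real.sin) Real.contDiff_sin]
      have h0 := hc0 k
      have h1 := ha1 k
      simp only [norm_mul]
      rw [Real.norm_of_nonneg (by positivity : 0 ≤ c k / a k),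
        Real.norm_of_nonneg (by positivity : 0 ≤ a k ^ s)]
      have h2 := Real.abs_iteratedDeriv_sin_le_one s (a k * x)
      have h3 : c k / a k ≤ c k := div_le_self h0.le h1
      calc c k / a k * (a k ^ s * ‖iteratedDeriv s Real.sin (a k * x)‖)
          ≤ c k * (a k ^ s * 1) := by gcongr; exact h2
        _ = _ := by ring
  · intro x
    refine hasDerivAt_tsum (u := c) (g := fun k x => c k / a k * Real.sin (a k * x))
      (g' := fun k x => c k * Real.cos (a k * x)) (y₀ := 0) hsc ?_ ?_ ?_ x
    · intro k y
      have h1 := ha1 k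
      have h := (((hasDerivAt_id y).const_mul (a k)).sin).const_mul (c k / a k)
      have h2 : c k / a k * (Real.cos (a k * id y) * (a k * 1)) = c k * Real.cos (a k * y) := by
        simp only [id]
        field_simp
      rw [h2] at h
      exact h
    · intro k y
      rw [norm_mul, Real.norm_of_nonneg (hc0 k).le]
      exact mul_le_of_le_one_right (hc0 k).le (Real.abs_cos_le_one _)
    · simp
  · intro x p
    simp only
    congr 1
    funext k
    have h : a k * (x + p) = a k * x + ((q k * p : ℤ) : ℝ) * (2 * Real.pi) := by
      rw [ha]; push_cast; ring
    rw [h, Real.sin_add_int_mul_two_pi]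
  · intro n hn x
    have hn0 : (0 : ℝ) < n := by exact_mod_cast hn
    have hΨn := hΨpos n hn0
    simp only
    rw [hswap]
    have hex : ∃ k, n < N k := ⟨n + 1, lt_of_lt_of_le (Nat.lt_succ_self n) (hNmono.id_le (n + 1))⟩
    classical
    have hk := Nat.find_spec hex
    have hkmin : ∀ j < Nat.find hex, ¬ n < N j := fun j hj => Nat.find_min hex hj
    set k := Nat.find hex
    rw [← (hsumD n x).sum_add_tsum_nat_add k]
    refine (abs_add_le _ _).trans ?_
    have hA : 4 * ∑ j ∈ Finset.range k, Ψ (N j) ≤ 5 * Ψ n := by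
      rcases Nat.eq_zero_or_pos k with h0 | h0
      · rw [h0]; simp; exact hΨn.le
      · obtain ⟨j, hj⟩ : ∃ j, k = j + 1 := ⟨k - 1, by omega⟩
        rw [hj, Finset.sum_range_succ]
        have h1 : N j ≤ n := not_lt.mp (hkmin j (by omega))
        have h2 : Ψ (N j) ≤ Ψ n := hΨmono (by exact_mod_cast h1)
        linarith [hpre j]
    have hcgeo : ∀ i, c (i + k) ≤ c k * (1 / 2) ^ i := by
      intro i
      induction i with
      | zero => simp
      | succ i ih =>
        rw [show i + 1 + k = (i + k) + 1 by ring, pow_succ]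
        linarith [hc2' (i + k)]
    have hck : c k * n ≤ Ψ n := by
      have := hrec k n hn hk.le
      rw [hc]
      rwa [le_div_iff₀ hn0] at this
    have hB : |∑' j, c (j + k) * ∑ i ∈ Finset.range n,
        Real.cos (a (j + k) * x + i * (2 * Real.pi * δ (j + k)))| ≤ 2 * Ψ n := by
      have hb : ∀ j, ‖c (j + k) * ∑ i ∈ Finset.range n,
        Real.cos (a (j + k) * x + i * (2 * Real.pi * δ (j + k)))‖ ≤ Ψ n * (1 / 2) ^ j := by
        intro j
        rw [norm_mul, Real.norm_of_nonneg (hc0 _).le]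
        calc _ ≤ (c k * (1 / 2) ^ j) * n := by
              have := hc0 k
              gcongr
              · exact hcgeo j
              · exact hD1 _ _ _
          _ = (c k * n) * (1 / 2) ^ j := by ring
          _ ≤ _ := by gcongr
      have := tsum_of_norm_bounded (hasSum_geometric_two.mul_left (Ψ n)) hb
      rw [Real.norm_eq_abs] at this
      linarith
    linarith [hlowpart k n x]
  · refine (hNmono.tendsto_atTop).frequently (p := fun n : ℕ => Ψ n / 4 ≤
      |∑ i ∈ Finset.range n, ∑' k, c k * Real.cos (a k * (0 + i * α))|)
      (Eventually.frequently (Eventually.of_forall fun k => ?_))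
    rw [hswap, ← (hsumD (N k) 0).sum_add_tsum_nat_add k]
    refine le_trans ?_ (le_abs_self _)
    have hA := (abs_le.mp (hlowpart k (N k) 0)).1
    have hp := hpre k
    have hlow : ∀ j, k ≤ j → (N k : ℝ) / 2 ≤ ∑ i ∈ Finset.range (N k),
        Real.cos (a j * 0 + i * (2 * Real.pi * δ j)) := by
      intro j hj
      rw [mul_zero]
      exact cos_sum_lower (δ j) (N j) (N k) (hN j) (hNmono.monotone hj) (hδ0 j) (hδ2 j)
    have hs' := (summable_nat_add_iff k).mpr (hsumD (N k) 0)
    have hB := hs'.le_tsum 0 (fun j _ => mul_nonneg (hc0 _).le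
      (le_trans (by positivity) (hlow (j + k) (by omega))))
    have hC : Ψ (N k) / 2 ≤ c (0 + k) * ∑ i ∈ Finset.range (N k),
        Real.cos (a (0 + k) * 0 + i * (2 * Real.pi * δ (0 + k))) := by
      rw [zero_add, ← hcN]
      calc c k * N k / 2 = c k * (N k / 2) := by ring
        _ ≤ _ := mul_le_mul_of_nonneg_left (hlow k le_rfl) (hc0 k).le
    linarith

/-- The instance of the main theorem for the torus `𝕋²` acting on itself: for every
admissible `Ψ` there is a smooth, area-preserving diffeomorphism `f` of `ℝ²` commuting
with integer translations (hence descending to `𝕋² = ℝ²/ℤ²`) whose growth sequence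
satisfies `0 < limsup Γ_n(f)/Ψ(n) < ∞`. -/
theorem slow_area_preserving_torus_diffeo_exists
    (Ψ : ℝ → ℝ)
    (hΨpos : ∀ x > 0, 0 < Ψ x)
    (hΨmono : Monotone Ψ)
    (hΨunbdd : Tendsto Ψ atTop atTop)
    (hΨo : Ψ =o[atTop] fun x => x) :
    ∃ f g : ℝ × ℝ → ℝ × ℝ,
      ContDiff ℝ (⊤ : ℕ∞) f ∧ ContDiff ℝ (⊤ : ℕ∞) g ∧
      Function.LeftInverse g f ∧ Function.RightInverse g f ∧
      MeasurePreserving f volume volume ∧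
      (∀ (x y : ℝ) (p q : ℤ),
        f (x + p, y + q) = ((f (x, y)).1 + p, (f (x, y)).2 + q)) ∧
      0 < Filter.limsup
          (fun n : ℕ =>
            (((max (⨆ z : ℝ × ℝ, ‖fderiv ℝ (f^[n]) z‖)
                   (⨆ z : ℝ × ℝ, ‖fderiv ℝ (g^[n]) z‖))
              / Ψ n : ℝ) : EReal))
          atTop ∧
      Filter.limsup
          (fun n : ℕ =>
            (((max (⨆ z : ℝ × ℝ, ‖fderiv ℝ (f^[n]) z‖)
                   (⨆ z : ℝ × ℝ, ‖fderiv ℝ (g^[n]) z‖))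
              / Ψ n : ℝ) : EReal))
          atTop < ⊤ := by
  obtain ⟨α, φ, ψ, h1, h2, h3, h4, h5⟩ := slow_main Ψ hΨpos hΨmono hΨunbdd hΨo
  exact dynamics_reduction Ψ hΨpos hΨunbdd α φ ψ h1 h2 h3 h4 h5
end
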